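/- For every labeled polytree sequent λ, every label w, and every structure X, the following pairs of display sequents are mutually derivable in DKtP: D^w_1(λ) ⊢ X and *D^w_2(λ) ⊢ X; *D^w_1(λ) ⊢ X and D^w_2(λ) ⊢ X; X ⊢ D^w_2(λ) and X ⊢ *D^w_1(λ); X ⊢ *D^w_2(λ) and X ⊢ D^w_1(λ). -/

import Mathlib

set_option linter.unusedVariables false

/-- Formulae of the tense language `L`. -/
inductive Fm : Type where
  | atom : Nat → Fm
  | top : Fm
  | bot : Fm
  | neg : Fm → Fm
  | or : Fm → Fm → Fm
  | and : Fm → Fm → Fm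
  | imp : Fm → Fm → Fm
  | box : Fm → Fm
  | dia : Fm → Fm
  | boxP : Fm → Fm
  | diaP : Fm → Fm
deriving DecidableEq

instance : Inhabited Fm := ⟨Fm.top⟩

/-- The language `L_{∧,◇,♦}`. -/
inductive SimpFm : Fm → Prop where
  | atom (p : Nat) : SimpFm (.atom p)
  | top : SimpFm .top
  | and {A B : Fm} : SimpFm A → SimpFm B → SimpFm (.and A B)
  | dia {A : Fm} : SimpFm A → SimpFm (.dia A)
  | diaP {A : Fm} : SimpFm A → SimpFm (.diaP A)

/-- The grammar `A ::= p | ⊤ | (A∧A) | (A∨A) | ◇A | ♦A` of primitive tense axioms. -/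
inductive PrimFm : Fm → Prop where
  | atom (p : Nat) : PrimFm (.atom p)
  | top : PrimFm .top
  | and {A B : Fm} : PrimFm A → PrimFm B → PrimFm (.and A B)
  | or {A B : Fm} : PrimFm A → PrimFm B → PrimFm (.or A B)
  | dia {A : Fm} : PrimFm A → PrimFm (.dia A)
  | diaP {A : Fm} : PrimFm A → PrimFm (.diaP A)

/-- Number of occurrences of the atom `p` in a formula. -/
def atomCount : Fm → Nat → Nat
  | .atom q, p => if q = p then 1 else 0
  | .top, _ => 0
  | .bot, _ => 0
  | .neg A, p => atomCount A p
  | .or A B, p => atomCount A p + atomCount B p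
  | .and A B, p => atomCount A p + atomCount B p
  | .imp A B, p => atomCount A p + atomCount B p
  | .box A, p => atomCount A p
  | .dia A, p => atomCount A p
  | .boxP A, p => atomCount A p
  | .diaP A, p => atomCount A p

/-- `A` contains each propositional atom at most once. -/
def AtomsOnce (A : Fm) : Prop := ∀ p, atomCount A p ≤ 1

/-- A simplified primitive tense axiom, encoded as its antecedent together with the
(nonempty) list of its disjuncts. -/
def ValidAx (x : Fm × List Fm) : Prop :=
  SimpFm x.1 ∧ AtomsOnce x.1 ∧ x.2 ≠ [] ∧ ∀ B ∈ x.2, SimpFm B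

/-- A set of simplified primitive tense axioms. -/
def ValidAxSet (P : Set (Fm × List Fm)) : Prop := ∀ x ∈ P, ValidAx x

/-- Display structures `X ::= A | I | *X | •X | (X∘X)`. -/
inductive Str : Type where
  | fm : Fm → Str
  | I : Str
  | star : Str → Str
  | bullet : Str → Str
  | comp : Str → Str → Str
deriving DecidableEq

/-- Display sequents `X ⊢ Y`. -/
structure DSeq : Type where
  ant : Str
  suc : Str
deriving DecidableEq

/-- Length of a structure. -/
def Str.len : Str → Nat
  | .fm _ => 1
  | .I => 1
  | .star X => X.len + 1
  | .bullet X => X.len + 1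
  | .comp X Y => X.len + Y.len + 1

/-- Length of a display sequent. -/
def DSeq.len (d : DSeq) : Nat := d.ant.len + d.suc.len

/-- The translation `ψ` from formulae of `L_{∧,◇,♦}` to (schematic) structures, where the
structure variable `Ẋ_p` for each atom `p` is instantiated by `θ p`. -/
def psiStr (θ : Nat → Str) : Fm → Str
  | .atom p => θ p
  | .top => .I
  | .and A B => .comp (psiStr θ A) (psiStr θ B)
  | .dia A => .star (.bullet (.star (psiStr θ A)))
  | .diaP A => .bullet (psiStr θ A)
  | _ => .I

/-- Labeled sequents `R, Γ ⇒ Δ`: a set of relational atoms together with multisets of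
labeled formulae on the left and on the right. -/
structure LSeq : Type where
  rel : Finset (Nat × Nat)
  ant : Multiset (Nat × Fm)
  suc : Multiset (Nat × Fm)

/-- The empty labeled sequent. -/
def LSeq.empty : LSeq := ⟨∅, 0, 0⟩
instance : Inhabited LSeq := ⟨LSeq.empty⟩

/-- Sequent composition `⊗`. -/
def LSeq.comp (s t : LSeq) : LSeq := ⟨s.rel ∪ t.rel, s.ant + t.ant, s.suc + t.suc⟩

/-- The labeled sequent `w : A ⇒ ∅`. -/
def Fq (w : Nat) (A : Fm) : LSeq := ⟨∅, {(w, A)}, 0⟩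
/-- The labeled sequent `∅ ⇒ w : A`. -/
def Gq (w : Nat) (A : Fm) : LSeq := ⟨∅, 0, {(w, A)}⟩
/-- The labeled sequent `Rwu ⇒ ∅`. -/
def Rl (w u : Nat) : LSeq := ⟨{(w, u)}, 0, 0⟩

/-- The labels occurring in a labeled sequent. -/
def LSeq.labels (s : LSeq) : Finset Nat :=
  s.rel.image Prod.fst ∪ s.rel.image Prod.snd ∪
    (s.ant.map Prod.fst).toFinset ∪ (s.suc.map Prod.fst).toFinset

/-- The length `|R| + |Γ| + |Δ|` of a labeled sequent. -/
def LSeq.len (s : LSeq) : Nat := s.rel.card + Multiset.card s.ant + Multiset.card s.suc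

/-- Applying a label substitution to a labeled sequent. -/
def LSeq.rename (f : Nat → Nat) (s : LSeq) : LSeq :=
  ⟨s.rel.image (fun e => (f e.1, f e.2)),
   s.ant.map (fun x => (f x.1, x.2)),
   s.suc.map (fun x => (f x.1, x.2))⟩

/-- The (undirected simple) graph of a labeled sequent: labels as vertices, and an edge
between `a` and `b` for each relational atom `Rab`. -/
def LSeq.graph (s : LSeq) : SimpleGraph Nat :=
  SimpleGraph.fromRel (fun a b => (a, b) ∈ s.rel)

/-- `s` is a labeled polytree sequent: (1) if `R = ∅` then `s` is `w`-flat for some `w`;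
(2) if `R ≠ ∅` then every label of `Γ, Δ` occurs in `R`; (3) the graph of `s` is connected
and free of directed and undirected cycles. -/
def IsPolytree (s : LSeq) : Prop :=
  (s.rel = ∅ → ∃ w, (∀ x ∈ s.ant, x.1 = w) ∧ (∀ x ∈ s.suc, x.1 = w)) ∧
  (s.rel ≠ ∅ →
    (∀ x ∈ s.ant, x.1 ∈ s.rel.image Prod.fst ∪ s.rel.image Prod.snd) ∧
    (∀ x ∈ s.suc, x.1 ∈ s.rel.image Prod.fst ∪ s.rel.image Prod.snd)) ∧
  (∀ a, (a, a) ∉ s.rel) ∧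
  (∀ a b, (a, b) ∈ s.rel → (b, a) ∉ s.rel) ∧
  s.graph.IsAcyclic ∧
  (∀ a ∈ s.labels, ∀ b ∈ s.labels, s.graph.Reachable a b)

/-- Isomorphism of labeled sequents: a bijection between the label sets preserving and
reflecting relational atoms and labeled formulae on each side. -/
def LSeq.Iso (s t : LSeq) : Prop :=
  ∃ f : Nat → Nat, Set.BijOn f ↑s.labels ↑t.labels ∧
    (∀ a b, (a, b) ∈ s.rel → (f a, f b) ∈ t.rel) ∧
    (∀ a b, a ∈ s.labels → b ∈ s.labels → (f a, f b) ∈ t.rel → (a, b) ∈ s.rel) ∧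
    (∀ a A, (a, A) ∈ s.ant → (f a, A) ∈ t.ant) ∧
    (∀ a A, a ∈ s.labels → (f a, A) ∈ t.ant → (a, A) ∈ s.ant) ∧
    (∀ a A, (a, A) ∈ s.suc → (f a, A) ∈ t.suc) ∧
    (∀ a A, a ∈ s.labels → (f a, A) ∈ t.suc → (a, A) ∈ s.suc)

/-- The rules of Kracht's display calculus `DKtP` for the primitive tense logic
axiomatized by the set `P` of simplified primitive tense axioms, given as a relation
between the list of premises and the conclusion. -/
inductive DRule (P : Set (Fm × List Fm)) : List DSeq → DSeq → Prop where
  | id (p : Nat) : DRule P [] ⟨.fm (.atom p), .fm (.atom p)⟩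
  | topR : DRule P [] ⟨.I, .fm .top⟩
  | botL : DRule P [] ⟨.fm .bot, .I⟩
  | topL (Y : Str) : DRule P [⟨.I, Y⟩] ⟨.fm .top, Y⟩
  | botR (X : Str) : DRule P [⟨X, .I⟩] ⟨X, .fm .bot⟩
  | negL (A : Fm) (Y : Str) : DRule P [⟨.star (.fm A), Y⟩] ⟨.fm (.neg A), Y⟩
  | negR (A : Fm) (X : Str) : DRule P [⟨X, .star (.fm A)⟩] ⟨X, .fm (.neg A)⟩
  | impR (A B : Fm) (X : Str) : DRule P [⟨.comp X (.fm A), .fm B⟩] ⟨X, .fm (.imp A B)⟩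
  | impL (A B : Fm) (X Y : Str) :
      DRule P [⟨X, .fm A⟩, ⟨.fm B, Y⟩] ⟨.fm (.imp A B), .comp (.star X) Y⟩
  | orR (A B : Fm) (X : Str) : DRule P [⟨X, .comp (.fm A) (.fm B)⟩] ⟨X, .fm (.or A B)⟩
  | orL (A B : Fm) (Y : Str) : DRule P [⟨.fm A, Y⟩, ⟨.fm B, Y⟩] ⟨.fm (.or A B), Y⟩
  | andL (A B : Fm) (Y : Str) : DRule P [⟨.comp (.fm A) (.fm B), Y⟩] ⟨.fm (.and A B), Y⟩
  | andR (A B : Fm) (X : Str) : DRule P [⟨X, .fm A⟩, ⟨X, .fm B⟩] ⟨X, .fm (.and A B)⟩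
  | boxL (A : Fm) (Y : Str) : DRule P [⟨.fm A, Y⟩] ⟨.fm (.box A), .bullet Y⟩
  | boxR (A : Fm) (X : Str) : DRule P [⟨.bullet X, .fm A⟩] ⟨X, .fm (.box A)⟩
  | diaL (A : Fm) (Y : Str) :
      DRule P [⟨.fm A, .star (.bullet (.star Y))⟩] ⟨.fm (.dia A), Y⟩
  | diaR (A : Fm) (X : Str) :
      DRule P [⟨X, .fm A⟩] ⟨.star (.bullet (.star X)), .fm (.dia A)⟩
  | boxPR (A : Fm) (X : Str) :
      DRule P [⟨.star (.bullet (.star X)), .fm A⟩] ⟨X, .fm (.boxP A)⟩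
  | boxPL (A : Fm) (Y : Str) :
      DRule P [⟨.fm A, Y⟩] ⟨.fm (.boxP A), .star (.bullet (.star Y))⟩
  | diaPL (A : Fm) (Y : Str) : DRule P [⟨.fm A, .bullet Y⟩] ⟨.fm (.diaP A), Y⟩
  | diaPR (A : Fm) (X : Str) : DRule P [⟨X, .fm A⟩] ⟨.bullet X, .fm (.diaP A)⟩
  | d1a (X Y Z : Str) : DRule P [⟨.comp X Y, Z⟩] ⟨X, .comp Z (.star Y)⟩
  | d1b (X Y Z : Str) : DRule P [⟨X, .comp Z (.star Y)⟩] ⟨.comp X Y, Z⟩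
  | d2a (X Y Z : Str) : DRule P [⟨.comp X Y, Z⟩] ⟨Y, .comp (.star X) Z⟩
  | d2b (X Y Z : Str) : DRule P [⟨Y, .comp (.star X) Z⟩] ⟨.comp X Y, Z⟩
  | d3a (X Y Z : Str) : DRule P [⟨X, .comp Y Z⟩] ⟨.comp X (.star Z), Y⟩
  | d3b (X Y Z : Str) : DRule P [⟨.comp X (.star Z), Y⟩] ⟨X, .comp Y Z⟩
  | d4a (X Y Z : Str) : DRule P [⟨X, .comp Y Z⟩] ⟨.comp (.star Y) X, Z⟩
  | d4b (X Y Z : Str) : DRule P [⟨.comp (.star Y) X, Z⟩] ⟨X, .comp Y Z⟩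
  | d5a (X Y : Str) : DRule P [⟨.star X, Y⟩] ⟨.star Y, X⟩
  | d5b (X Y : Str) : DRule P [⟨.star Y, X⟩] ⟨.star X, Y⟩
  | d6a (X Y : Str) : DRule P [⟨X, .star Y⟩] ⟨Y, .star X⟩
  | d6b (X Y : Str) : DRule P [⟨Y, .star X⟩] ⟨X, .star Y⟩
  | d7a (X Y : Str) : DRule P [⟨.star (.star X), Y⟩] ⟨X, Y⟩
  | d7b (X Y : Str) : DRule P [⟨X, Y⟩] ⟨.star (.star X), Y⟩
  | d8a (X Y : Str) : DRule P [⟨X, .star (.star Y)⟩] ⟨X, Y⟩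
  | d8b (X Y : Str) : DRule P [⟨X, Y⟩] ⟨X, .star (.star Y)⟩
  | d9a (X Y : Str) : DRule P [⟨X, .bullet Y⟩] ⟨.bullet X, Y⟩
  | d9b (X Y : Str) : DRule P [⟨.bullet X, Y⟩] ⟨X, .bullet Y⟩
  | ila (X Y : Str) : DRule P [⟨X, Y⟩] ⟨.comp .I X, Y⟩
  | ilb (X Y : Str) : DRule P [⟨.comp .I X, Y⟩] ⟨X, Y⟩
  | ira (X Y : Str) : DRule P [⟨X, Y⟩] ⟨X, .comp .I Y⟩
  | irb (X Y : Str) : DRule P [⟨X, .comp .I Y⟩] ⟨X, Y⟩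
  | qla (Y : Str) : DRule P [⟨.I, Y⟩] ⟨.star .I, Y⟩
  | qlb (Y : Str) : DRule P [⟨.star .I, Y⟩] ⟨.I, Y⟩
  | qra (X : Str) : DRule P [⟨X, .I⟩] ⟨X, .star .I⟩
  | qrb (X : Str) : DRule P [⟨X, .star .I⟩] ⟨X, .I⟩
  | wl (X Y Z : Str) : DRule P [⟨X, Y⟩] ⟨.comp Z X, Y⟩
  | wr (X Y Z : Str) : DRule P [⟨X, Y⟩] ⟨X, .comp Y Z⟩
  | ala (X Y Z W : Str) : DRule P [⟨.comp X (.comp Y Z), W⟩] ⟨.comp (.comp X Y) Z, W⟩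
  | alb (X Y Z W : Str) : DRule P [⟨.comp (.comp X Y) Z, W⟩] ⟨.comp X (.comp Y Z), W⟩
  | ara (X Y Z W : Str) : DRule P [⟨X, .comp Y (.comp Z W)⟩] ⟨X, .comp (.comp Y Z) W⟩
  | arb (X Y Z W : Str) : DRule P [⟨X, .comp (.comp Y Z) W⟩] ⟨X, .comp Y (.comp Z W)⟩
  | pl (X Y Z : Str) : DRule P [⟨.comp X Y, Z⟩] ⟨.comp Y X, Z⟩
  | pr (X Y Z : Str) : DRule P [⟨X, .comp Y Z⟩] ⟨X, .comp Z Y⟩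
  | cl (X Y : Str) : DRule P [⟨.comp X X, Y⟩] ⟨X, Y⟩
  | cr (X Y : Str) : DRule P [⟨X, .comp Y Y⟩] ⟨X, Y⟩
  | ml (Y : Str) : DRule P [⟨.I, Y⟩] ⟨.bullet .I, Y⟩
  | mr (X : Str) : DRule P [⟨X, .I⟩] ⟨X, .bullet .I⟩
  | cut (A : Fm) (X Y : Str) : DRule P [⟨X, .fm A⟩, ⟨.fm A, Y⟩] ⟨X, Y⟩
  | pt (A : Fm) (Bs : List Fm) (θ : Nat → Str) (X : Str) :
      (A, Bs) ∈ P →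
      DRule P (Bs.map (fun B => ⟨psiStr θ B, X⟩)) ⟨psiStr θ A, X⟩

/-- Derivability in the display calculus `DKtP` from a set `H` of hypothesis sequents. -/
inductive DPH (P : Set (Fm × List Fm)) (H : Set DSeq) : DSeq → Prop where
  | hyp {d : DSeq} : d ∈ H → DPH P H d
  | node {prems : List DSeq} {concl : DSeq} :
      DRule P prems concl → (∀ p ∈ prems, DPH P H p) → DPH P H concl

/-- `IsComp ms X` holds when the structure `X` is a `∘`-composition of exactly the
formulae in the multiset `ms` (being `I` when `ms` is empty). -/
inductive IsComp : Multiset Fm → Str → Prop where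
  | nil : IsComp 0 .I
  | single (A : Fm) : IsComp {A} (.fm A)
  | comp {s t : Multiset Fm} {X Y : Str} :
      IsComp s X → IsComp t Y → IsComp (s + t) (.comp X Y)

/-- `DT1 λ w X` holds when `X` is a result of the translation `D^w_1` applied to the
labeled polytree sequent `λ` rooted at `w`: formulae labeled `w` are rendered as
`(Γ↾w) ∘ *(Δ↾w)`, a subpolytree attached by an outgoing edge `Rwu` is rendered via
`*•*D^u_1`, and a subpolytree attached by an incoming edge `Rvw` is rendered via
`•D^v_1`. -/
inductive DT1 : LSeq → Nat → Str → Prop where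
  | flat {Γ Δ : Multiset Fm} {X Y : Str} (w : Nat) :
      IsComp Γ X → IsComp Δ Y →
      DT1 ⟨∅, Γ.map (fun A => (w, A)), Δ.map (fun A => (w, A))⟩ w (.comp X (.star Y))
  | out {s t : LSeq} {w u : Nat} {X Y : Str} :
      DT1 s w X → DT1 t u Y → w ≠ u → w ∉ t.labels → u ∉ s.labels →
      s.labels ∩ t.labels = ∅ →
      DT1 (s.comp ((Rl w u).comp t)) w (.comp X (.star (.bullet (.star Y))))
  | inn {s t : LSeq} {w v : Nat} {X Y : Str} :
      DT1 s w X → DT1 t v Y → w ≠ v → w ∉ t.labels → v ∉ s.labels →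
      s.labels ∩ t.labels = ∅ →
      DT1 (s.comp ((Rl v w).comp t)) w (.comp X (.bullet Y))
  | glue {s t : LSeq} {w : Nat} {X Y : Str} :
      DT1 s w X → DT1 t w Y → s.labels ∩ t.labels ⊆ {w} →
      DT1 (s.comp t) w (.comp X Y)

/-- `DT2 λ w X` holds when `X` is a result of the translation `D^w_2` (dual to `D^w_1`)
applied to the labeled polytree sequent `λ` rooted at `w`. -/
inductive DT2 : LSeq → Nat → Str → Prop where
  | flat {Γ Δ : Multiset Fm} {X Y : Str} (w : Nat) :
      IsComp Γ X → IsComp Δ Y →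
      DT2 ⟨∅, Γ.map (fun A => (w, A)), Δ.map (fun A => (w, A))⟩ w (.comp (.star X) Y)
  | out {s t : LSeq} {w u : Nat} {X Y : Str} :
      DT2 s w X → DT2 t u Y → w ≠ u → w ∉ t.labels → u ∉ s.labels →
      s.labels ∩ t.labels = ∅ →
      DT2 (s.comp ((Rl w u).comp t)) w (.comp X (.bullet Y))
  | inn {s t : LSeq} {w v : Nat} {X Y : Str} :
      DT2 s w X → DT2 t v Y → w ≠ v → w ∉ t.labels → v ∉ s.labels →
      s.labels ∩ t.labels = ∅ →
      DT2 (s.comp ((Rl v w).comp t)) w (.comp X (.star (.bullet (.star Y))))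
  | glue {s t : LSeq} {w : Nat} {X Y : Str} :
      DT2 s w X → DT2 t w Y → s.labels ∩ t.labels ⊆ {w} →
      DT2 (s.comp t) w (.comp X Y)

/-- `λ1 ⊗_w λ2` is a `w`-partition of `λ`: `λ = λ1 ⊗ λ2` with `λ1, λ2` labeled polytree
sequents whose label sets intersect exactly in `{w}`. -/
def WPart (lam s t : LSeq) (w : Nat) : Prop :=
  lam = s.comp t ∧ IsPolytree s ∧ IsPolytree t ∧ s.labels ∩ t.labels = {w}

/-- `DTr λ w δ` holds when the display sequent `δ` is a result of the translation `D_w`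
applied to `λ`: for some `w`-partition `λ = λ1 ⊗_w λ2`, the antecedent of `δ` is a result
of `D^w_1(λ1)` and the succedent a result of `D^w_2(λ2)`. -/
def DTr (lam : LSeq) (w : Nat) (d : DSeq) : Prop :=
  ∃ s t, WPart lam s t w ∧ DT1 s w d.ant ∧ DT2 t w d.suc

theorem DPH.step {P : Set (Fm × List Fm)} {H : Set DSeq} {d e : DSeq}
    (r : DRule P [d] e) (h : DPH P H d) : DPH P H e :=
  .node r (by simpa using h)

section Display

variable {P : Set (Fm × List Fm)} {H : Set DSeq} (X Y Z : Str)

theorem DPH.comp_ant_left :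
    DPH P H ⟨.comp X Y, Z⟩ ↔ DPH P H ⟨X, .comp Z (.star Y)⟩ :=
  ⟨.step (.d1a ..), .step (.d1b ..)⟩

theorem DPH.comp_ant_right :
    DPH P H ⟨.comp X Y, Z⟩ ↔ DPH P H ⟨Y, .comp (.star X) Z⟩ :=
  ⟨.step (.d2a ..), .step (.d2b ..)⟩

theorem DPH.comp_suc_left :
    DPH P H ⟨X, .comp Y Z⟩ ↔ DPH P H ⟨.comp X (.star Z), Y⟩ :=
  ⟨.step (.d3a ..), .step (.d3b ..)⟩

theorem DPH.comp_suc_right :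
    DPH P H ⟨X, .comp Y Z⟩ ↔ DPH P H ⟨.comp (.star Y) X, Z⟩ :=
  ⟨.step (.d4a ..), .step (.d4b ..)⟩

theorem DPH.star_ant : DPH P H ⟨.star X, Y⟩ ↔ DPH P H ⟨.star Y, X⟩ :=
  ⟨.step (.d5a ..), .step (.d5a ..)⟩

theorem DPH.star_suc : DPH P H ⟨X, .star Y⟩ ↔ DPH P H ⟨Y, .star X⟩ :=
  ⟨.step (.d6a ..), .step (.d6a ..)⟩

theorem DPH.bullet_suc : DPH P H ⟨X, .bullet Y⟩ ↔ DPH P H ⟨.bullet X, Y⟩ :=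
  ⟨.step (.d9a ..), .step (.d9b ..)⟩

theorem DPH.comp_ant_comm : DPH P H ⟨.comp X Y, Z⟩ ↔ DPH P H ⟨.comp Y X, Z⟩ :=
  ⟨.step (.pl ..), .step (.pl ..)⟩

theorem DPH.comp_suc_comm : DPH P H ⟨X, .comp Y Z⟩ ↔ DPH P H ⟨X, .comp Z Y⟩ :=
  ⟨.step (.pr ..), .step (.pr ..)⟩

end Display

/-- Interderivability of two structures, both as antecedents and as succedents. -/
def Str.Equiv (P : Set (Fm × List Fm)) (X Y : Str) : Prop :=
  ∀ (H : Set DSeq) (Z : Str), (DPH P H ⟨X, Z⟩ ↔ DPH P H ⟨Y, Z⟩) ∧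
    (DPH P H ⟨Z, X⟩ ↔ DPH P H ⟨Z, Y⟩)

namespace Str.Equiv

variable {P : Set (Fm × List Fm)}

theorem refl (X : Str) : Str.Equiv P X X := fun _ _ => ⟨Iff.rfl, Iff.rfl⟩

theorem symm {X Y : Str} (h : Str.Equiv P X Y) : Str.Equiv P Y X :=
  fun H Z => ⟨(h H Z).1.symm, (h H Z).2.symm⟩

theorem trans {X Y W : Str} (h : Str.Equiv P X Y) (k : Str.Equiv P Y W) : Str.Equiv P X W :=
  fun H Z => ⟨(h H Z).1.trans (k H Z).1, (h H Z).2.trans (k H Z).2⟩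

theorem star {X Y : Str} (h : Str.Equiv P X Y) : Str.Equiv P (.star X) (.star Y) := by
  refine fun H Z => ⟨?_, ?_⟩
  · rw [DPH.star_ant, (h _ _).2, DPH.star_ant]
  · rw [DPH.star_suc, (h _ _).1, DPH.star_suc]

theorem bullet {X Y : Str} (h : Str.Equiv P X Y) : Str.Equiv P (.bullet X) (.bullet Y) := by
  refine fun H Z => ⟨?_, ?_⟩
  · rw [← DPH.bullet_suc, (h _ _).1, DPH.bullet_suc]
  · rw [DPH.bullet_suc, (h _ _).2, DPH.bullet_suc]

theorem comp_comm (X Y : Str) : Str.Equiv P (.comp X Y) (.comp Y X) :=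
  fun _ _ => ⟨DPH.comp_ant_comm .., DPH.comp_suc_comm ..⟩

theorem comp_left {X Y : Str} (h : Str.Equiv P X Y) (W : Str) :
    Str.Equiv P (.comp X W) (.comp Y W) := by
  refine fun H Z => ⟨?_, ?_⟩
  · rw [DPH.comp_ant_left, (h _ _).1, DPH.comp_ant_left]
  · rw [DPH.comp_suc_left, (h _ _).2, DPH.comp_suc_left]

theorem comp {X Y X' Y' : Str} (h : Str.Equiv P X X') (k : Str.Equiv P Y Y') :
    Str.Equiv P (.comp X Y) (.comp X' Y') :=
  ((h.comp_left Y).trans (comp_comm _ _)).trans ((k.comp_left X').trans (comp_comm _ _))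

theorem comp_assoc (X Y Z : Str) :
    Str.Equiv P (.comp (.comp X Y) Z) (.comp X (.comp Y Z)) :=
  fun _ _ => ⟨⟨.step (.alb ..), .step (.ala ..)⟩, ⟨.step (.arb ..), .step (.ara ..)⟩⟩

theorem I_comp (X : Str) : Str.Equiv P (.comp .I X) X :=
  fun _ _ => ⟨⟨.step (.ilb ..), .step (.ila ..)⟩, ⟨.step (.irb ..), .step (.ira ..)⟩⟩

theorem star_I : Str.Equiv P (.star .I) .I :=
  fun _ _ => ⟨⟨.step (.qlb ..), .step (.qla ..)⟩, ⟨.step (.qrb ..), .step (.qra ..)⟩⟩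

theorem star_star (X : Str) : Str.Equiv P (.star (.star X)) X :=
  fun _ _ => ⟨⟨.step (.d7a ..), .step (.d7b ..)⟩, ⟨.step (.d8a ..), .step (.d8b ..)⟩⟩

theorem star_comp (X Y : Str) :
    Str.Equiv P (.star (.comp X Y)) (.comp (.star X) (.star Y)) := by
  refine fun H Z => ⟨?_, ?_⟩
  · rw [DPH.star_ant, DPH.comp_suc_right, DPH.comp_ant_comm, ← DPH.comp_suc_right,
      DPH.comp_ant_left, ((refl Z).comp (star_star Y) _ _).2]
  · rw [DPH.star_suc, DPH.comp_ant_left, ← DPH.comp_ant_right, DPH.comp_ant_comm,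
      DPH.comp_suc_right, ((star_star X).comp_left Z _ _).1]

end Str.Equiv

/-- Structures up to interderivability. -/
def StrQuot (P : Set (Fm × List Fm)) : Type :=
  Quotient (⟨Str.Equiv P, ⟨.refl, .symm, .trans⟩⟩ : Setoid Str)

namespace StrQuot

variable {P : Set (Fm × List Fm)}

/-- The class of a structure. -/
def mk (P : Set (Fm × List Fm)) (X : Str) : StrQuot P := Quotient.mk _ X

theorem mk_eq_mk {X Y : Str} : mk P X = mk P Y ↔ Str.Equiv P X Y := Quotient.eq

instance : Zero (StrQuot P) := ⟨mk P .I⟩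

instance : Add (StrQuot P) :=
  ⟨Quotient.map₂ Str.comp fun _ _ h _ _ k => Str.Equiv.comp h k⟩

instance : AddCommMonoid (StrQuot P) where
  add_assoc := by
    rintro ⟨X⟩ ⟨Y⟩ ⟨Z⟩
    exact mk_eq_mk.2 (.comp_assoc X Y Z)
  zero_add := by
    rintro ⟨X⟩
    exact mk_eq_mk.2 (.I_comp X)
  add_zero := by
    rintro ⟨X⟩
    exact mk_eq_mk.2 ((Str.Equiv.comp_comm _ _).trans (.I_comp X))
  add_comm := by
    rintro ⟨X⟩ ⟨Y⟩
    exact mk_eq_mk.2 (.comp_comm X Y)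
  nsmul := nsmulRec

theorem mk_I : mk P .I = 0 := rfl

theorem mk_comp (X Y : Str) : mk P (.comp X Y) = mk P X + mk P Y := rfl

/-- The structural connective `*` as an additive endomorphism. -/
def star : StrQuot P →+ StrQuot P where
  toFun := Quotient.map Str.star fun _ _ h => Str.Equiv.star h
  map_zero' := mk_eq_mk.2 .star_I
  map_add' := by
    rintro ⟨X⟩ ⟨Y⟩
    exact mk_eq_mk.2 (.star_comp X Y)

/-- The structural connective `•`. -/
def bullet : StrQuot P → StrQuot P :=
  Quotient.map Str.bullet fun _ _ h => Str.Equiv.bullet h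

theorem mk_star (X : Str) : mk P (.star X) = star (mk P X) := rfl

theorem mk_bullet (X : Str) : mk P (.bullet X) = bullet (mk P X) := rfl

theorem star_star (q : StrQuot P) : star (star q) = q := by
  obtain ⟨X⟩ := q
  exact mk_eq_mk.2 (.star_star X)

theorem mk_eq_sum_of_isComp {ms : Multiset Fm} {X : Str} (h : IsComp ms X) :
    mk P X = (ms.map fun A => mk P (.fm A)).sum := by
  induction h with
  | nil => rfl
  | single A => simp
  | comp _ _ hs ht => simp [mk_comp, hs, ht]

/-- The contribution of the formulae labeled `w` to the value of a labeled sequent. -/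
def flatValue (P : Set (Fm × List Fm)) (s : LSeq) (w : Nat) : StrQuot P :=
  ((s.ant.filter (·.1 = w)).map fun x => mk P (.fm x.2)).sum +
    star ((s.suc.filter (·.1 = w)).map fun x => mk P (.fm x.2)).sum

/-- The class of `D^w_1` for the part of `s` reachable from `w` by paths of length less than
the first argument which avoid the labels in `F`. -/
def treeValue (P : Set (Fm × List Fm)) (s : LSeq) : Nat → Nat → Finset Nat → StrQuot P
  | 0, _, _ => 0
  | n + 1, w, F => flatValue P s w +
      ∑ e ∈ s.rel with e.1 = w ∧ e.2 ∉ insert w F,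
        star (bullet (star (treeValue P s n e.2 (insert w F)))) +
      ∑ e ∈ s.rel with e.2 = w ∧ e.1 ∉ insert w F,
        bullet (treeValue P s n e.1 (insert w F))

theorem treeValue_congr {L s : LSeq} {C : Nat → Prop}
    (hflat : ∀ x, C x → flatValue P L x = flatValue P s x) (n : Nat) :
    ∀ {F F' : Finset Nat} {x : Nat},
      (∀ y z, C y → (((y, z) ∈ L.rel ∧ z ∉ F) ↔ ((y, z) ∈ s.rel ∧ z ∉ F'))) →
      (∀ y z, C y → (((z, y) ∈ L.rel ∧ z ∉ F) ↔ ((z, y) ∈ s.rel ∧ z ∉ F'))) →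
      (∀ y z, C y → (y, z) ∈ s.rel ∨ (z, y) ∈ s.rel → z ∉ F' → C z) →
      C x → treeValue P L n x F = treeValue P s n x F' := by
  induction n with
  | zero => intros; rfl
  | succ n ih =>
    intro F F' x hout hin hC hx
    have key : ∀ z, C z →
        treeValue P L n z (insert x F) = treeValue P s n z (insert x F') := by
      intro z hz
      refine ih ?_ ?_ ?_ hz
      · intro y z hy; have := hout y z hy; simp only [Finset.mem_insert]; tauto
      · intro y z hy; have := hin y z hy; simp only [Finset.mem_insert]; tauto
      · intro y z hy h hz; exact hC y z hy h (by simp at hz; tauto)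
    simp only [treeValue, hflat x hx]
    congr 1
    · congr 1
      refine Finset.sum_congr ?_ ?_
      · ext ⟨a, b⟩
        simp only [Finset.mem_filter, Finset.mem_insert]
        constructor <;> rintro ⟨h, rfl, h'⟩ <;> have := hout _ b hx <;> tauto
      · rintro ⟨a, b⟩ h
        simp only [Finset.mem_filter, Finset.mem_insert] at h
        obtain ⟨h, rfl, h'⟩ := h
        have := hC _ b hx (.inl h) (by tauto)
        rw [key b this]
    · refine Finset.sum_congr ?_ ?_
      · ext ⟨a, b⟩
        simp only [Finset.mem_filter, Finset.mem_insert]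
        constructor <;> rintro ⟨h, rfl, h'⟩ <;> have := hin _ a hx <;> tauto
      · rintro ⟨a, b⟩ h
        simp only [Finset.mem_filter, Finset.mem_insert] at h
        obtain ⟨h, rfl, h'⟩ := h
        have := hC _ a hx (.inr h) (by tauto)
        rw [key a this]

end StrQuot

namespace LSeq

theorem fst_mem_labels {s : LSeq} {a b : Nat} (h : (a, b) ∈ s.rel) : a ∈ s.labels := by
  simp only [labels, Finset.mem_union, Finset.mem_image]
  exact .inl (.inl (.inl ⟨_, h, rfl⟩))

theorem snd_mem_labels {s : LSeq} {a b : Nat} (h : (a, b) ∈ s.rel) : b ∈ s.labels := by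
  simp only [labels, Finset.mem_union, Finset.mem_image]
  exact .inl (.inl (.inr ⟨_, h, rfl⟩))

theorem mem_labels_of_mem_ant {s : LSeq} {x : Nat × Fm} (h : x ∈ s.ant) : x.1 ∈ s.labels := by
  simp only [labels, Finset.mem_union, Multiset.mem_toFinset, Multiset.mem_map]
  exact .inl (.inr ⟨_, h, rfl⟩)

theorem mem_labels_of_mem_suc {s : LSeq} {x : Nat × Fm} (h : x ∈ s.suc) : x.1 ∈ s.labels := by
  simp only [labels, Finset.mem_union, Multiset.mem_toFinset, Multiset.mem_map]
  exact .inr ⟨_, h, rfl⟩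

theorem labels_comp (s t : LSeq) : (s.comp t).labels = s.labels ∪ t.labels := by
  ext x
  simp only [labels, comp, Finset.image_union, Multiset.map_add, Multiset.toFinset_add,
    Finset.mem_union]
  tauto

theorem labels_Rl (w u : Nat) : (Rl w u).labels = {w, u} := by
  ext x
  simp [labels, Rl]

theorem comp_comm (s t : LSeq) : s.comp t = t.comp s := by
  simp [comp, Finset.union_comm, add_comm]

end LSeq

namespace StrQuot

variable {P : Set (Fm × List Fm)}

theorem flatValue_comp (s t : LSeq) (w : Nat) :
    flatValue P (s.comp t) w = flatValue P s w + flatValue P t w := by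
  simp only [flatValue, LSeq.comp, Multiset.filter_add, Multiset.map_add, Multiset.sum_add,
    map_add]
  exact add_add_add_comm ..

theorem flatValue_Rl (a b w : Nat) : flatValue P (Rl a b) w = 0 := by
  simp [flatValue, Rl]

theorem flatValue_of_notMem_labels {s : LSeq} {w : Nat} (h : w ∉ s.labels) :
    flatValue P s w = 0 := by
  have h1 : s.ant.filter (·.1 = w) = 0 :=
    Multiset.filter_eq_nil.2 fun x hx hw => h (hw ▸ LSeq.mem_labels_of_mem_ant hx)
  have h2 : s.suc.filter (·.1 = w) = 0 :=
    Multiset.filter_eq_nil.2 fun x hx hw => h (hw ▸ LSeq.mem_labels_of_mem_suc hx)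
  simp [flatValue, h1, h2]

theorem treeValue_comp_of_mem_labels {s t : LSeq} {w x : Nat}
    (hst : s.labels ∩ t.labels ⊆ {w}) (hx : x ∈ s.labels) (hxw : x ≠ w) (n : Nat) :
    treeValue P (s.comp t) n x {w} = treeValue P s n x {w} := by
  have ht : ∀ y, (y ∈ s.labels ∧ y ≠ w) → y ∉ t.labels := fun y hy hyt =>
    hy.2 (Finset.mem_singleton.1 (hst (Finset.mem_inter.2 ⟨hy.1, hyt⟩)))
  refine treeValue_congr (C := fun y => y ∈ s.labels ∧ y ≠ w) ?_ n ?_ ?_ ?_ ⟨hx, hxw⟩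
  · intro y hy
    rw [flatValue_comp, flatValue_of_notMem_labels (ht y hy), add_zero]
  · intro y z hy
    have : (y, z) ∉ t.rel := fun h => ht y hy (LSeq.fst_mem_labels h)
    simp [LSeq.comp, this]
  · intro y z hy
    have : (z, y) ∉ t.rel := fun h => ht y hy (LSeq.snd_mem_labels h)
    simp [LSeq.comp, this]
  · rintro y z - (h | h) hz
    · exact ⟨LSeq.snd_mem_labels h, by simpa using hz⟩
    · exact ⟨LSeq.fst_mem_labels h, by simpa using hz⟩

theorem treeValue_comp {s t : LSeq} {w : Nat} (hst : s.labels ∩ t.labels ⊆ {w}) (n : Nat) :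
    treeValue P (s.comp t) n w ∅ = treeValue P s n w ∅ + treeValue P t n w ∅ := by
  cases n with
  | zero => simp [treeValue]
  | succ n =>
    have hts : t.labels ∩ s.labels ⊆ {w} := by rwa [Finset.inter_comm]
    have hs : ∀ x ∈ s.labels, x ≠ w →
        treeValue P (s.comp t) n x {w} = treeValue P s n x {w} :=
      fun x hx hxw => treeValue_comp_of_mem_labels hst hx hxw n
    have ht : ∀ x ∈ t.labels, x ≠ w →
        treeValue P (s.comp t) n x {w} = treeValue P t n x {w} := fun x hx hxw => by
      rw [LSeq.comp_comm, treeValue_comp_of_mem_labels hts hx hxw n]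
    have hw : ∀ x ∈ s.labels, x ∈ t.labels → x = w := fun x hx hy =>
      Finset.mem_singleton.1 (hst (Finset.mem_inter.2 ⟨hx, hy⟩))
    simp only [treeValue, insert_empty_eq, flatValue_comp, Finset.mem_singleton]
    have h1 : ∑ e ∈ (s.comp t).rel with e.1 = w ∧ ¬ e.2 = w,
          star (bullet (star (treeValue P (s.comp t) n e.2 {w}))) =
        ∑ e ∈ s.rel with e.1 = w ∧ ¬ e.2 = w, star (bullet (star (treeValue P s n e.2 {w}))) +
        ∑ e ∈ t.rel with e.1 = w ∧ ¬ e.2 = w,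
          star (bullet (star (treeValue P t n e.2 {w}))) := by
      rw [LSeq.comp, Finset.filter_union, Finset.sum_union]
      · congr 1 <;> refine Finset.sum_congr rfl fun e he => ?_ <;>
          obtain ⟨he, -, hne⟩ := Finset.mem_filter.1 he
        · rw [← hs _ (LSeq.snd_mem_labels he) hne]; rfl
        · rw [← ht _ (LSeq.snd_mem_labels he) hne]; rfl
      · refine Finset.disjoint_left.2 fun e he he' => ?_
        obtain ⟨he, -, hne⟩ := Finset.mem_filter.1 he
        exact hne (hw _ (LSeq.snd_mem_labels he)
          (LSeq.snd_mem_labels (Finset.mem_filter.1 he').1))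
    have h2 : ∑ e ∈ (s.comp t).rel with e.2 = w ∧ ¬ e.1 = w,
          bullet (treeValue P (s.comp t) n e.1 {w}) =
        ∑ e ∈ s.rel with e.2 = w ∧ ¬ e.1 = w, bullet (treeValue P s n e.1 {w}) +
        ∑ e ∈ t.rel with e.2 = w ∧ ¬ e.1 = w, bullet (treeValue P t n e.1 {w}) := by
      rw [LSeq.comp, Finset.filter_union, Finset.sum_union]
      · congr 1 <;> refine Finset.sum_congr rfl fun e he => ?_ <;>
          obtain ⟨he, -, hne⟩ := Finset.mem_filter.1 he
        · rw [← hs _ (LSeq.fst_mem_labels he) hne]; rfl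
        · rw [← ht _ (LSeq.fst_mem_labels he) hne]; rfl
      · refine Finset.disjoint_left.2 fun e he he' => ?_
        obtain ⟨he, -, hne⟩ := Finset.mem_filter.1 he
        exact hne (hw _ (LSeq.fst_mem_labels he)
          (LSeq.fst_mem_labels (Finset.mem_filter.1 he').1))
    rw [h1, h2]
    abel

/-- A new edge at the root does not change the value of the tree hanging below it. -/
theorem treeValue_edge_comp {t : LSeq} {a b w u : Nat} (hab : a = w ∨ b = w) (hwu : w ≠ u)
    (hw : w ∉ t.labels) (n : Nat) :
    treeValue P ((Rl a b).comp t) n u {w} = treeValue P t n u ∅ := by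
  refine treeValue_congr (C := fun y => y ≠ w) ?_ n ?_ ?_ ?_ hwu.symm
  · intro y _
    rw [flatValue_comp, flatValue_Rl, zero_add]
  · intro y z hy
    have : (y, z) ∈ t.rel → z ≠ w := fun h hz => hw (hz ▸ LSeq.snd_mem_labels h)
    simp [LSeq.comp, Rl]
    grind
  · intro y z hy
    have : (z, y) ∈ t.rel → z ≠ w := fun h hz => hw (hz ▸ LSeq.fst_mem_labels h)
    simp [LSeq.comp, Rl]
    grind
  · rintro y z - (h | h) - rfl
    · exact hw (LSeq.snd_mem_labels h)
    · exact hw (LSeq.fst_mem_labels h)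

theorem treeValue_out {t : LSeq} {w u : Nat} (hwu : w ≠ u) (hw : w ∉ t.labels) (n : Nat) :
    treeValue P ((Rl w u).comp t) (n + 1) w ∅ =
      star (bullet (star (treeValue P t n u ∅))) := by
  have h1 : ((Rl w u).comp t).rel.filter (fun e => e.1 = w ∧ ¬ e.2 = w) = {(w, u)} := by
    ext ⟨a, b⟩
    have : (w, b) ∉ t.rel := fun h => hw (LSeq.fst_mem_labels h)
    simp [LSeq.comp, Rl]
    grind
  have h2 : ((Rl w u).comp t).rel.filter (fun e => e.2 = w ∧ ¬ e.1 = w) = ∅ := by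
    ext ⟨a, b⟩
    have : (a, w) ∉ t.rel := fun h => hw (LSeq.snd_mem_labels h)
    simp [LSeq.comp, Rl]
    grind
  simp [treeValue, h1, h2, flatValue_comp, flatValue_Rl, flatValue_of_notMem_labels hw,
    treeValue_edge_comp (.inl rfl) hwu hw]

theorem treeValue_inn {t : LSeq} {w v : Nat} (hwv : w ≠ v) (hw : w ∉ t.labels) (n : Nat) :
    treeValue P ((Rl v w).comp t) (n + 1) w ∅ = bullet (treeValue P t n v ∅) := by
  have h1 : ((Rl v w).comp t).rel.filter (fun e => e.1 = w ∧ ¬ e.2 = w) = ∅ := by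
    ext ⟨a, b⟩
    have : (w, b) ∉ t.rel := fun h => hw (LSeq.fst_mem_labels h)
    simp [LSeq.comp, Rl]
    grind
  have h2 : ((Rl v w).comp t).rel.filter (fun e => e.2 = w ∧ ¬ e.1 = w) = {(v, w)} := by
    ext ⟨a, b⟩
    have : (a, w) ∉ t.rel := fun h => hw (LSeq.snd_mem_labels h)
    simp [LSeq.comp, Rl]
    grind
  simp [treeValue, h1, h2, flatValue_comp, flatValue_Rl, flatValue_of_notMem_labels hw,
    treeValue_edge_comp (.inr rfl) hwv hw]

theorem treeValue_flat (Γ Δ : Multiset Fm) (w n : Nat) :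
    treeValue P ⟨∅, Γ.map (fun A => (w, A)), Δ.map (fun A => (w, A))⟩ (n + 1) w ∅ =
      (Γ.map fun A => mk P (.fm A)).sum + star (Δ.map fun A => mk P (.fm A)).sum := by
  simp [treeValue, flatValue, Multiset.filter_map]

theorem inter_labels_subset {s t : LSeq} {a b w u : Nat}
    (hab : (a = w ∧ b = u) ∨ (a = u ∧ b = w))
    (hu : u ∉ s.labels) (hst : s.labels ∩ t.labels = ∅) :
    s.labels ∩ ((Rl a b).comp t).labels ⊆ {w} := by
  intro x hx
  have := Finset.eq_empty_iff_forall_notMem.1 hst x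
  simp only [LSeq.labels_comp, LSeq.labels_Rl, Finset.mem_inter, Finset.mem_union,
    Finset.mem_insert, Finset.mem_singleton] at hx this ⊢
  grind

theorem treeValue_eq_of_DT1 {s : LSeq} {w : Nat} {X : Str} (h : DT1 s w X) :
    ∃ N, ∀ n ≥ N, treeValue P s n w ∅ = mk P X := by
  induction h with
  | flat w hX hY =>
    refine ⟨1, fun n hn => ?_⟩
    obtain ⟨n, rfl⟩ := Nat.exists_eq_add_of_le' hn
    rw [treeValue_flat, mk_comp, mk_star, mk_eq_sum_of_isComp hX, mk_eq_sum_of_isComp hY]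
  | out _ _ hwu hw hu hst ihs iht =>
    obtain ⟨N, hN⟩ := ihs
    obtain ⟨M, hM⟩ := iht
    refine ⟨N + M + 1, fun n hn => ?_⟩
    obtain ⟨n, rfl⟩ := Nat.exists_eq_add_of_le' (Nat.le_of_add_left_le hn)
    rw [treeValue_comp (inter_labels_subset (.inl ⟨rfl, rfl⟩) hu hst), hN _ (by lia),
      treeValue_out hwu hw, hM _ (by lia)]
    rfl
  | inn _ _ hwv hw hv hst ihs iht =>
    obtain ⟨N, hN⟩ := ihs
    obtain ⟨M, hM⟩ := iht
    refine ⟨N + M + 1, fun n hn => ?_⟩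
    obtain ⟨n, rfl⟩ := Nat.exists_eq_add_of_le' (Nat.le_of_add_left_le hn)
    rw [treeValue_comp (inter_labels_subset (.inr ⟨rfl, rfl⟩) hv hst), hN _ (by lia),
      treeValue_inn hwv hw, hM _ (by lia)]
    rfl
  | glue _ _ hst ihs iht =>
    obtain ⟨N, hN⟩ := ihs
    obtain ⟨M, hM⟩ := iht
    refine ⟨N + M, fun n hn => ?_⟩
    rw [treeValue_comp hst, hN _ (by lia), hM _ (by lia), mk_comp]

theorem treeValue_eq_of_DT2 {s : LSeq} {w : Nat} {X : Str} (h : DT2 s w X) :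
    ∃ N, ∀ n ≥ N, treeValue P s n w ∅ = star (mk P X) := by
  induction h with
  | flat w hX hY =>
    refine ⟨1, fun n hn => ?_⟩
    obtain ⟨n, rfl⟩ := Nat.exists_eq_add_of_le' hn
    rw [treeValue_flat, mk_comp, map_add, mk_star, star_star, mk_eq_sum_of_isComp hX,
      mk_eq_sum_of_isComp hY]
  | out _ _ hwu hw hu hst ihs iht =>
    obtain ⟨N, hN⟩ := ihs
    obtain ⟨M, hM⟩ := iht
    refine ⟨N + M + 1, fun n hn => ?_⟩
    obtain ⟨n, rfl⟩ := Nat.exists_eq_add_of_le' (Nat.le_of_add_left_le hn)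
    rw [treeValue_comp (inter_labels_subset (.inl ⟨rfl, rfl⟩) hu hst), hN _ (by lia),
      treeValue_out hwu hw, hM _ (by lia), star_star, mk_comp, map_add, mk_bullet]
  | inn _ _ hwv hw hv hst ihs iht =>
    obtain ⟨N, hN⟩ := ihs
    obtain ⟨M, hM⟩ := iht
    refine ⟨N + M + 1, fun n hn => ?_⟩
    obtain ⟨n, rfl⟩ := Nat.exists_eq_add_of_le' (Nat.le_of_add_left_le hn)
    rw [treeValue_comp (inter_labels_subset (.inr ⟨rfl, rfl⟩) hv hst), hN _ (by lia),
      treeValue_inn hwv hw, hM _ (by lia), mk_comp, map_add, mk_star, star_star, mk_bullet,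
      mk_star]
  | glue _ _ hst ihs iht =>
    obtain ⟨N, hN⟩ := ihs
    obtain ⟨M, hM⟩ := iht
    refine ⟨N + M, fun n hn => ?_⟩
    rw [treeValue_comp hst, hN _ (by lia), hM _ (by lia), mk_comp, map_add]

end StrQuot

/-- `D^w_1` and `*D^w_2` are interderivable. -/
theorem Str.Equiv.of_DT1_of_DT2 (P : Set (Fm × List Fm)) {s : LSeq} {w : Nat} {X Y : Str}
    (h1 : DT1 s w X) (h2 : DT2 s w Y) : Str.Equiv P X (.star Y) := by
  obtain ⟨N, hN⟩ := StrQuot.treeValue_eq_of_DT1 (P := P) h1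
  obtain ⟨M, hM⟩ := StrQuot.treeValue_eq_of_DT2 (P := P) h2
  rw [← StrQuot.mk_eq_mk, ← hN (N + M) (by lia), hM (N + M) (by lia), StrQuot.mk_star]

/-- For every labeled polytree sequent `λ`, every label `w`, and every
structure `Z`, the pairs `D^w_1(λ) ⊢ Z` / `*D^w_2(λ) ⊢ Z`, `*D^w_1(λ) ⊢ Z` / `D^w_2(λ) ⊢ Z`,
`Z ⊢ D^w_2(λ)` / `Z ⊢ *D^w_1(λ)` and `Z ⊢ *D^w_2(λ)` / `Z ⊢ D^w_1(λ)` are mutually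
derivable in `DKtP`. -/
theorem d1_d2_equivalence (P : Set (Fm × List Fm)) (hP : ValidAxSet P)
    (lam : LSeq) (hpt : IsPolytree lam) (w : Nat) (S1 S2 Z : Str)
    (h1 : DT1 lam w S1) (h2 : DT2 lam w S2) :
    (DPH P {⟨S1, Z⟩} ⟨.star S2, Z⟩ ∧ DPH P {⟨.star S2, Z⟩} ⟨S1, Z⟩) ∧
    (DPH P {⟨.star S1, Z⟩} ⟨S2, Z⟩ ∧ DPH P {⟨S2, Z⟩} ⟨.star S1, Z⟩) ∧
    (DPH P {⟨Z, S2⟩} ⟨Z, .star S1⟩ ∧ DPH P {⟨Z, .star S1⟩} ⟨Z, S2⟩) ∧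
    (DPH P {⟨Z, .star S2⟩} ⟨Z, S1⟩ ∧ DPH P {⟨Z, S1⟩} ⟨Z, .star S2⟩) := by
  have h := Str.Equiv.of_DT1_of_DT2 P h1 h2
  have h' : Str.Equiv P (.star S1) S2 := h.star.trans (.star_star S2)
  exact ⟨⟨(h _ _).1.1 (.hyp rfl), (h _ _).1.2 (.hyp rfl)⟩,
    ⟨(h' _ _).1.1 (.hyp rfl), (h' _ _).1.2 (.hyp rfl)⟩,
    ⟨(h' _ _).2.2 (.hyp rfl), (h' _ _).2.1 (.hyp rfl)⟩,
    ⟨(h _ _).2.2 (.hyp rfl), (h _ _).2.1 (.hyp rfl)⟩⟩
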